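/- Let X be an infinite topological space and (Xn) a superskeleton for X. Then for every n ∈ ℕ the subspace Xn is crowded (has no isolated points in its subspace topology). -/

import Mathlib

open Set Topology TopologicalSpace

/-- "Regular" in the sense of the paper: Hausdorff + the T₃ separation property. -/
def RegularHausdorff (X : Type*) [TopologicalSpace X] : Prop :=
  T2Space X ∧ RegularSpace X

/-- A space is superconnected if the closures of any finitely many nonempty open
sets have nonempty intersection. -/
def Superconnected (X : Type*) [TopologicalSpace X] : Prop :=
  ∀ (n : ℕ) (U : Fin (n + 1) → Set X), (∀ i, IsOpen (U i)) → (∀ i, (U i).Nonempty) →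
    (⋂ i, closure (U i)).Nonempty

/-- A space is coregular if it is Hausdorff and the complement of the intersection
of the closures of any finitely many nonempty open sets is a regular space. -/
def Coregular (X : Type*) [TopologicalSpace X] : Prop :=
  T2Space X ∧ ∀ (n : ℕ) (U : Fin (n + 1) → Set X), (∀ i, IsOpen (U i)) →
    (∀ i, (U i).Nonempty) → RegularHausdorff ↥((⋂ i, closure (U i))ᶜ)

/-- Vanishing sequence of closed sets. -/
def VanishingSeq {X : Type*} [TopologicalSpace X] (A : ℕ → Set X) : Prop :=
  (∀ n, IsClosed (A n)) ∧ A 0 = univ ∧ (⋂ n, A n) = ∅ ∧ ∀ n, A (n + 1) ⊆ A n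

def IsCoregularSkeleton {X : Type*} [TopologicalSpace X] (A : ℕ → Set X) : Prop :=
  VanishingSeq A ∧
  (∀ U : Set X, IsOpen U → U.Nonempty → ∃ n, A n ⊆ closure U) ∧
  (∀ n, RegularHausdorff ↥((A n)ᶜ))

def IsSuperconnectingSkeleton {X : Type*} [TopologicalSpace X] (A : ℕ → Set X) : Prop :=
  VanishingSeq A ∧
  ∀ U : Set X, IsOpen U → U.Nonempty → ∃ n, (A n).Nonempty ∧ A n ⊆ closure U

def IsInductivelySuperconnectingSkeleton {X : Type*} [TopologicalSpace X]
    (A : ℕ → Set X) : Prop :=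
  VanishingSeq A ∧
  ∀ (n : ℕ) (V : Set X), IsOpen V → (V ∩ A n).Nonempty →
    ∃ m, (A m).Nonempty ∧ A m ⊆ closure (V ∩ A n)

def IsSuperskeleton {X : Type*} [TopologicalSpace X] (A : ℕ → Set X) : Prop :=
  IsCoregularSkeleton A ∧ IsInductivelySuperconnectingSkeleton A

def IsCanonicalSuperskeleton {X : Type*} [TopologicalSpace X] (A : ℕ → Set X) : Prop :=
  IsSuperskeleton A ∧
  ∀ n, IsNowhereDense ((Subtype.val ⁻¹' A (n + 1)) : Set ↥(A n))

/-- Points of the projective space: finitely supported nonzero sequences. -/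
abbrev ProjPoint (F : Type*) [Field F] : Type _ :=
  {x : ℕ → F // {n | x n ≠ 0}.Finite ∧ x ≠ 0}

/-- Proportionality of finitely supported nonzero sequences. -/
def projSetoid (F : Type*) [Field F] : Setoid (ProjPoint F) where
  r x y := ∃ l : F, l ≠ 0 ∧ (x : ℕ → F) = l • (y : ℕ → F)
  iseqv := by
    refine ⟨fun x => ⟨1, one_ne_zero, by simp⟩, ?_, ?_⟩
    · rintro x y ⟨l, hl, h⟩
      exact ⟨l⁻¹, inv_ne_zero hl, by rw [h, smul_smul, inv_mul_cancel₀ hl, one_smul]⟩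
    · rintro x y z ⟨l, hl, h⟩ ⟨m, hm, h'⟩
      exact ⟨l * m, mul_ne_zero hl hm, by rw [h, h', smul_smul]⟩

/-- The infinite projective space of a topological field. -/
abbrev ProjSpace (F : Type*) [Field F] [TopologicalSpace F] : Type _ :=
  Quotient (projSetoid F)

/-- The infinite rational projective space ℚP^∞. -/
abbrev QPinf : Type := ProjSpace ℚ


/-- A vanishing sequence of closed sets is antitone. -/
theorem VanishingSeq.antitone {X : Type*} [TopologicalSpace X] {A : ℕ → Set X}
    (hA : VanishingSeq A) : Antitone A :=
  antitone_nat_of_succ_le hA.2.2.2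

theorem VanishingSeq.exists_notMem {X : Type*} [TopologicalSpace X] {A : ℕ → Set X}
    (hA : VanishingSeq A) (x : X) : ∃ n, x ∉ A n := by
  have hx : x ∉ ⋂ n, A n := by simp [hA.2.2.1]
  simpa using hx

/-- A space with a coregular skeleton is Hausdorff. -/
theorem IsCoregularSkeleton.t2Space {X : Type*} [TopologicalSpace X] {A : ℕ → Set X}
    (hA : IsCoregularSkeleton A) : T2Space X := by
  obtain ⟨hv, -, hreg⟩ := hA
  refine ⟨fun x y hxy => ?_⟩
  obtain ⟨i, hi⟩ := hv.exists_notMem x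
  obtain ⟨j, hj⟩ := hv.exists_notMem y
  have hx : x ∈ (A (max i j))ᶜ := fun h => hi (hv.antitone (le_max_left i j) h)
  have hy : y ∈ (A (max i j))ᶜ := fun h => hj (hv.antitone (le_max_right i j) h)
  have := (hreg (max i j)).1
  obtain ⟨U, V, hU, hV, hxU, hyV, hUV⟩ :=
    t2_separation (show (⟨x, hx⟩ : ↥((A (max i j))ᶜ)) ≠ ⟨y, hy⟩ by simpa using hxy)
  have ho : IsOpenMap (Subtype.val : ↥((A (max i j))ᶜ) → X) :=
    (hv.1 _).isOpen_compl.isOpenMap_subtype_val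
  exact ⟨_, _, ho U hU, ho V hV, mem_image_of_mem _ hxU, mem_image_of_mem _ hyV,
    (disjoint_image_iff Subtype.val_injective).2 hUV⟩

/-- if X is infinite with a superskeleton (Xₙ), then each subspace Xₙ is
crowded (no isolated points in the subspace topology). -/
theorem crowded_subspaces_of_superskeleton (X : Type*) [TopologicalSpace X]
    (hinf : Infinite X) (A : ℕ → Set X) (hA : IsSuperskeleton A) :
    ∀ n, ∀ x : ↥(A n), ¬ IsOpen ({x} : Set ↥(A n)) := by
  intro n x hx
  obtain ⟨hcor, hv, hsup⟩ := hA
  have := hcor.t2Space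
  obtain ⟨V, hV, hVx⟩ := isOpen_induced_iff.1 hx
  have hVA : V ∩ A n = {(x : X)} := by
    rw [inter_comm, ← Subtype.image_preimage_coe, hVx, image_singleton]
  obtain ⟨m, hm, hmx⟩ := hsup n V hV (hVA ▸ singleton_nonempty _)
  rw [hVA, closure_singleton] at hmx
  have hmem : ∀ k, (A k).Nonempty → (x : X) ∈ A k := by
    rintro k ⟨z, hz⟩
    rcases le_total k m with hkm | hmk
    · obtain ⟨w, hw⟩ := hm
      exact hv.antitone hkm (hmx hw ▸ hw)
    · exact hmx (hv.antitone hmk hz) ▸ hz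
  obtain ⟨y, hy⟩ := exists_ne (x : X)
  obtain ⟨U, W, hU, hW, hyU, hxW, hUW⟩ := t2_separation hy
  obtain ⟨k, hk, hkU⟩ := hsup 0 U hU ⟨y, hyU, by simp [hv.2.1]⟩
  exact (hUW.closure_left hW).notMem_of_mem_left
    (closure_mono inter_subset_left (hkU (hmem k hk))) hxW
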